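/- arXiv:1512.07239 — 7 statements merged into one kernel-verified Lean document; each statement's English description precedes it below -/
import Mathlib

section
/- Let h_1, h_2, …, h_n be elements of F_{q^N} that are linearly independent over F_q (so n ≤ N), let s be a positive integer with gcd(s, N) = 1, and let d be an integer with 2 ≤ d ≤ n. Let C = {v ∈ F_{q^N}^n : Σ_{j=1}^{n} h_j^{q^{s·i}} v_j = 0 for all i = 0, 1, …, d−2}. Then C is an F_{q^N}-subspace of F_{q^N}^n of dimension n − d + 1, and every nonzero vector v ∈ C has rank weight at least d. -/
/-- A Moore matrix: if `σ` is an `F`-endomorphism of `K` whose fixed points all lie in `F`, then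
the vectors `(g k, σ (g k), …, σ ^ (m - 1) (g k))` are linearly independent over `K` as soon as
the `m` elements `g k` are linearly independent over `F`. -/
theorem linearIndependent_algHom_pow {F K : Type*} [Field F] [Field K] [Algebra F K]
    (σ : K →ₐ[F] K) (hσ : ∀ x, σ x = x → ∃ a, algebraMap F K a = x) {m : ℕ} (g : Fin m → K)
    (hg : LinearIndependent F g) :
    LinearIndependent K (fun k i : Fin m => (σ ^ (i : ℕ)) (g k)) := by
  rw [Fintype.linearIndependent_iff]
  suffices H : ∀ w : Fin m → K, (∀ i < m, ∑ k, (σ ^ i) (g k) * w k = 0) → ∀ k, w k = 0 by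
    refine fun w hw => H w fun i hi => ?_
    simpa [mul_comm] using congrFun hw ⟨i, hi⟩
  induction m with
  | zero => exact fun w _ k => k.elim0
  | succ m ih =>
    intro w hw
    have hg0 : g 0 ≠ 0 := hg.ne_zero 0
    set f : Fin (m + 1) → K := fun k => g k / g 0 with hf
    have hw' : ∀ i < m + 1, ∑ k, (σ ^ i) (f k) * w k = 0 := fun i hi => by
      simp only [hf, map_div₀, div_mul_eq_mul_div, ← Finset.sum_div, hw i hi, zero_div]
    have hdiff : LinearIndependent F fun k : Fin m => σ (f k.succ) - f k.succ := by
      rw [Fintype.linearIndependent_iff]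
      intro c hc k
      obtain ⟨a, ha⟩ := hσ (∑ k, c k • f k.succ) <| by
        simpa [smul_sub, Finset.sum_sub_distrib, sub_eq_zero] using hc
      have hsum : ∑ k, (Fin.cons (-a) c : Fin (m + 1) → F) k • g k = 0 := by
        have : algebraMap F K a * g 0 = ∑ k, c k • g k.succ := by
          rw [ha, Finset.sum_mul]
          exact Finset.sum_congr rfl fun k _ => by simp [hf, hg0]
        simp [Fin.sum_univ_succ, ← this, ← Algebra.smul_def, -Algebra.smul_mul_assoc]
      simpa using Fintype.linearIndependent_iff.mp hg _ hsum k.succ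
    have hsucc : ∀ k : Fin m, w k.succ = 0 := by
      refine ih _ hdiff (fun k => w k.succ) fun i hi => ?_
      have h1 := hw' (i + 1) (by lia)
      have h0 := hw' i (by lia)
      rw [Fin.sum_univ_succ] at h0 h1
      simp only [hf, div_self hg0, map_one, pow_succ, AlgHom.mul_apply] at h0 h1
      simp only [hf, map_sub, sub_mul, Finset.sum_sub_distrib]
      linear_combination h1 - h0
    have h0 : w 0 = 0 := by
      have := hw 0 (by lia)
      simpa [Fin.sum_univ_succ, hsucc, hg0] using this
    exact Fin.cases h0 hsucc

/-- If the iterates `σ ^ i` of an `F`-endomorphism with fixed field `F` are used as parity checks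
for `i < e`, a nonzero codeword has rank weight greater than `e`. -/
theorem lt_finrank_span_of_sum_algHom_pow_eq_zero {F K : Type*} [Field F] [Field K] [Algebra F K]
    (σ : K →ₐ[F] K) (hσ : ∀ x, σ x = x → ∃ a, algebraMap F K a = x) {n e : ℕ} (h : Fin n → K)
    (hlin : LinearIndependent F h) (v : Fin n → K)
    (hv : ∀ i < e, ∑ j, (σ ^ i) (h j) * v j = 0) (hv0 : v ≠ 0) :
    e < Module.finrank F (Submodule.span F (Set.range v)) := by
  by_contra! hle
  set W := Submodule.span F (Set.range v) with hW
  have : FiniteDimensional F W := .span_of_finite F (Set.finite_range v)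
  let b := Module.finBasis F W
  have hmem : ∀ j, v j ∈ W := fun j => Submodule.subset_span ⟨j, rfl⟩
  let a : Fin n → Fin (Module.finrank F W) → F := fun j k => b.repr ⟨v j, hmem j⟩ k
  have hva : ∀ j, v j = ∑ k, a j k • (b k : K) := fun j => by
    simpa only [map_sum, map_smul, Submodule.subtype_apply] using
      congrArg W.subtype (b.sum_repr ⟨v j, hmem j⟩).symm
  have hg : LinearIndependent F fun k => ∑ j, a j k • h j := by
    rw [Fintype.linearIndependent_iff]
    intro c hc k
    have hac : ∀ j, ∑ k, c k * a j k = 0 := by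
      refine Fintype.linearIndependent_iff.mp hlin _ ?_
      rw [← hc]
      simp only [Finset.smul_sum, Finset.sum_smul, smul_smul]
      exact Finset.sum_comm
    have hφ : b.constr F c = 0 := by
      refine LinearMap.ext_on_range (v := fun j => (⟨v j, hmem j⟩ : W)) ?_ fun j => ?_
      · apply Submodule.map_injective_of_injective W.subtype_injective
        rw [Submodule.map_span, ← Set.range_comp, Submodule.map_top, Submodule.range_subtype]
        rfl
      · simpa [Module.Basis.constr_apply_fintype, a, mul_comm] using hac j
    simpa using LinearMap.congr_fun hφ (b k)
  have hb : ∀ k, (b k : K) = 0 := by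
    refine Fintype.linearIndependent_iff.mp (linearIndependent_algHom_pow σ hσ _ hg) _ ?_
    funext i
    have := hv i (i.2.trans_le hle)
    simp only [hva, Finset.mul_sum] at this
    rw [Finset.sum_comm] at this
    simpa [Finset.sum_mul, mul_comm] using this
  exact hv0 (funext fun j => by simp [hva, hb])

/-- The fixed points of `x ↦ x ^ (q ^ s)` on an extension of `F_q` of degree coprime to `s` lie
in `F_q`. -/
theorem exists_algebraMap_eq_of_frobeniusAlgHom_pow_eq {F K : Type*} [Field F] [Fintype F]
    [Field K] [Algebra F K] {s : ℕ} (hgcd : Nat.gcd s (Module.finrank F K) = 1) (x : K)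
    (hx : (FiniteField.frobeniusAlgHom F K ^ s) x = x) : ∃ a, algebraMap F K a = x := by
  have hs : Function.IsPeriodicPt (FiniteField.frobeniusAlgHom F K) s x := by
    rwa [Function.IsPeriodicPt, Function.IsFixedPt, ← AlgHom.coe_pow]
  have hN : Function.IsPeriodicPt (FiniteField.frobeniusAlgHom F K) (Module.finrank F K) x := by
    rcases Nat.eq_zero_or_pos (Module.finrank F K) with h0 | hpos
    · rw [h0]
      exact Function.isPeriodicPt_zero _ _
    · have : FiniteDimensional F K := Module.finite_of_finrank_pos hpos
      have : Finite K := Module.finite_of_finite F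
      have := Fintype.ofFinite K
      rw [Function.IsPeriodicPt, Function.IsFixedPt, FiniteField.coe_frobeniusAlgHom,
        pow_iterate, ← Module.card_eq_pow_finrank]
      exact FiniteField.pow_card x
  have h1 := hs.gcd hN
  rw [hgcd] at h1
  have hxq : x ^ Fintype.card F = x := h1
  have hsplits : (Polynomial.X ^ Fintype.card F - Polynomial.X : Polynomial F).Splits := by
    rw [Polynomial.splits_iff_card_roots, FiniteField.roots_X_pow_card_sub_X,
      FiniteField.X_pow_card_sub_X_natDegree_eq F Fintype.one_lt_card]
    rfl
  refine hsplits.mem_range_of_isRoot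
    (FiniteField.X_pow_card_sub_X_ne_zero F Fintype.one_lt_card) (i := algebraMap F K) ?_
  simp [hxq]


/-- Gabidulin codes, Proposition 2.4: for h₁,…,hₙ ∈ F_{q^N} linearly
independent over F_q, s positive with gcd(s,N)=1 and 2 ≤ d ≤ n, the code
C = {v : Σ_j h_j^{q^{s·i}} v_j = 0 for i = 0,…,d−2} is an F_{q^N}-subspace of dimension
n − d + 1 all of whose nonzero vectors have rank weight at least d. -/
theorem gabidulin_MRD (q N n s d : ℕ)
    (Fq K : Type) [Field Fq] [Fintype Fq] [Field K] [Algebra Fq K]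
    (hq : Fintype.card Fq = q) (hN : Module.finrank Fq K = N)
    (h : Fin n → K) (hlin : LinearIndependent Fq h)
    (hs : 0 < s) (hgcd : Nat.gcd s N = 1) (hd2 : 2 ≤ d) (hdn : d ≤ n) :
    ∃ C : Submodule K (Fin n → K),
      (∀ v : Fin n → K,
        v ∈ C ↔ ∀ i : Fin (d - 1), ∑ j, h j ^ q ^ (s * (i : ℕ)) * v j = 0) ∧
      Module.finrank K C = n - d + 1 ∧
      ∀ v ∈ C, v ≠ 0 → d ≤ Module.finrank Fq (Submodule.span Fq (Set.range v)) := by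
  subst hq hN
  set σ := FiniteField.frobeniusAlgHom Fq K ^ s with hσ_def
  have hσ := exists_algebraMap_eq_of_frobeniusAlgHom_pow_eq hgcd
  have hpow : ∀ i x, (σ ^ i) x = x ^ Fintype.card Fq ^ (s * i) := fun i x => by
    rw [hσ_def, ← pow_mul, AlgHom.coe_pow, FiniteField.coe_frobeniusAlgHom, pow_iterate]
  let col : Fin n → Fin (d - 1) → K := fun j i => (σ ^ (i : ℕ)) (h j)
  let L := Fintype.linearCombination K col
  have hmem : ∀ v, v ∈ L.ker ↔ ∀ i : Fin (d - 1), ∑ j, (σ ^ (i : ℕ)) (h j) * v j = 0 := fun v => by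
    simp [L, col, Fintype.linearCombination_apply, funext_iff, mul_comm]
  refine ⟨L.ker, fun v => by simp only [hmem, hpow], ?_, fun v hv hv0 => ?_⟩
  · have hle : d - 1 ≤ n := by lia
    have hcol : LinearIndependent K (col ∘ Fin.castLE hle) :=
      linearIndependent_algHom_pow σ hσ _ (hlin.comp _ (Fin.castLE_injective hle))
    have hrange : L.range = ⊤ := by
      rw [Fintype.range_linearCombination, eq_top_iff,
        ← hcol.span_eq_top_of_card_eq_finrank' (by simp)]
      exact Submodule.span_mono (Set.range_comp_subset_range _ _)
    have := L.finrank_range_add_finrank_ker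
    rw [hrange, finrank_top, Module.finrank_fin_fun, Module.finrank_fin_fun] at this
    lia
  · have := lt_finrank_span_of_sum_algHom_pow_eq_zero σ hσ h hlin v
      (fun i hi => (hmem v).mp hv ⟨i, hi⟩) hv0
    lia
end

section
/- Singleton bound for rank codes: let n ≤ N and let M be a set of N×n matrices over F_q such that the rank of the difference of any two distinct elements of M is at least d, where 1 ≤ d ≤ n. Then |M| ≤ q^{N(n−d+1)}. -/
/-- A matrix whose columns with index at most `k` all vanish has rank at most `n - 1 - k`. -/
theorem Matrix.rank_le_of_col_eq_zero {K m : Type*} [Field K] [Fintype m] {n : ℕ}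
    (A : Matrix m (Fin n) K) (k : Fin n) (h : ∀ j ≤ k, ∀ i, A i j = 0) :
    A.rank ≤ n - 1 - k := by
  rw [← Matrix.rank_transpose, ← Fin.card_Ioi]
  refine Matrix.rank_le_card_of_support_subset _ _ fun j hj => ?_
  rw [Finset.coe_Ioi, Set.mem_Ioi]
  by_contra! hjk
  exact hj (funext (h j hjk))


/-- Singleton bound for rank codes: let n ≤ N and let S be a set of N×n
matrices over F_q such that the rank of the difference of any two distinct elements of S
is at least d, where 1 ≤ d ≤ n. Then |S| ≤ q^{N(n−d+1)}. -/
theorem singleton_bound_rank_codes (q N n d : ℕ) (F : Type) [Field F] [Fintype F]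
    (hF : Fintype.card F = q) (hd : 0 < d) (hdn : d ≤ n) (hnN : n ≤ N)
    (S : Set (Matrix (Fin N) (Fin n) F))
    (hS : ∀ A ∈ S, ∀ B ∈ S, A ≠ B → d ≤ (A - B).rank) :
    S.ncard ≤ q ^ (N * (n - d + 1)) := by
  have hle : n - d + 1 ≤ n := by omega
  let f : Matrix (Fin N) (Fin n) F → Matrix (Fin N) (Fin (n - d + 1)) F :=
    fun A => A.submatrix id (Fin.castLE hle)
  have hinj : Set.InjOn f S := by
    intro A hA B hB hAB
    by_contra hne
    have hlow := hS A hA B hB hne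
    have hup := Matrix.rank_le_of_col_eq_zero (A - B) ⟨n - d, by omega⟩ fun j hj i =>
      sub_eq_zero.mpr (congrFun (congrFun hAB i) ⟨j, Nat.lt_succ_of_le hj⟩)
    dsimp only at hup
    omega
  calc S.ncard = (f '' S).ncard := hinj.ncard_image.symm
    _ ≤ Nat.card (Matrix (Fin N) (Fin (n - d + 1)) F) := Set.ncard_le_card _
    _ = q ^ (N * (n - d + 1)) := by
      simp [Matrix, hF, ← pow_mul, mul_comm]
end

section
/- For every integer n ≥ 2 and every prime power q, there exists a set C of matrices of size (n choose 2) × n over F_q with |C| = q^n − 1 such that every matrix in C has rank n − 1 and the rank of the difference of any two distinct matrices in C is n − 1 (i.e., C is an equidistant constant-rank code of rank n − 1, rank distance n − 1, and size q^n − 1). -/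
/-- The matrix of `u ↦ v ∧ u`, with rows indexed by the pairs `i < j` in `Fin n`. -/
def wedgeMatrix {n : ℕ} {F : Type*} [Field F] (v : Fin n → F) :
    Matrix ((j : Fin n) × Fin j) (Fin n) F :=
  Matrix.of fun p => Pi.single p.1 (v (Fin.castLE p.1.2.le p.2)) -
    Pi.single (Fin.castLE p.1.2.le p.2) (v p.1)

theorem wedgeMatrix_sub {n : ℕ} {F : Type*} [Field F] (v w : Fin n → F) :
    wedgeMatrix (v - w) = wedgeMatrix v - wedgeMatrix w := by
  ext p k
  simp only [wedgeMatrix, Matrix.of_apply, Matrix.sub_apply, Pi.sub_apply, Pi.single_sub]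
  ring

theorem wedgeMatrix_mulVec {n : ℕ} {F : Type*} [Field F] (v u : Fin n → F)
    (p : (j : Fin n) × Fin j) :
    (wedgeMatrix v).mulVec u p =
      v (Fin.castLE p.1.2.le p.2) * u p.1 - v p.1 * u (Fin.castLE p.1.2.le p.2) := by
  change (Pi.single p.1 _ - Pi.single (Fin.castLE p.1.2.le p.2) _) ⬝ᵥ u = _
  rw [sub_dotProduct, single_dotProduct, single_dotProduct]

theorem wedgeMatrix_mulVec_eq_zero_iff {n : ℕ} {F : Type*} [Field F] (v u : Fin n → F) :
    (wedgeMatrix v).mulVec u = 0 ↔ ∀ i j, v i * u j = v j * u i := by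
  constructor
  · intro h
    have key : ∀ i j : Fin n, i < j → v i * u j = v j * u i := fun i j hij => by
      have := congrFun h ⟨j, ⟨i, hij⟩⟩
      rw [wedgeMatrix_mulVec] at this
      exact sub_eq_zero.mp this
    intro i j
    rcases lt_trichotomy i j with hij | rfl | hij
    · exact key i j hij
    · rfl
    · exact (key j i hij).symm
  · intro h
    ext p
    rw [wedgeMatrix_mulVec, h, sub_self, Pi.zero_apply]

theorem ker_wedgeMatrix {n : ℕ} {F : Type*} [Field F] {v : Fin n → F} (hv : v ≠ 0) :
    LinearMap.ker (wedgeMatrix v).mulVecLin = Submodule.span F {v} := by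
  ext u
  rw [LinearMap.mem_ker, Matrix.mulVecLin_apply, wedgeMatrix_mulVec_eq_zero_iff,
    Submodule.mem_span_singleton]
  constructor
  · intro h
    obtain ⟨k, hk⟩ := Function.ne_iff.mp hv
    rw [Pi.zero_apply] at hk
    refine ⟨u k / v k, funext fun j => ?_⟩
    rw [Pi.smul_apply, smul_eq_mul, div_mul_eq_mul_div, div_eq_iff hk]
    linear_combination -h k j
  · rintro ⟨c, rfl⟩ i j
    simp only [Pi.smul_apply, smul_eq_mul]
    ring

theorem rank_wedgeMatrix {n : ℕ} {F : Type*} [Field F] {v : Fin n → F} (hv : v ≠ 0) :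
    (wedgeMatrix v).rank = n - 1 := by
  have h := (wedgeMatrix v).mulVecLin.finrank_range_add_finrank_ker
  rw [ker_wedgeMatrix hv, finrank_span_singleton hv, Module.finrank_fin_fun] at h
  exact Nat.eq_sub_of_add_eq h

theorem card_sigma_fin_eq_choose_two (n : ℕ) :
    Fintype.card ((j : Fin n) × Fin j) = n.choose 2 := by
  simp only [Fintype.card_sigma, Fintype.card_fin]
  rw [Fin.sum_univ_eq_sum_range fun j => j, Finset.sum_range_id, Nat.choose_two_right]

/-- Proposition 2.5: for every integer n ≥ 2 and every prime power q, there
exists an equidistant constant-rank code of (n choose 2)×n matrices over F_q with rank n − 1,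
rank distance n − 1, and size q^n − 1. -/
theorem exists_equidistant_constant_rank_code (q n : ℕ) (F : Type) [Field F] [Fintype F]
    (hF : Fintype.card F = q) (hn : 2 ≤ n) :
    ∃ C : Finset (Matrix (Fin (n.choose 2)) (Fin n) F),
      C.card = q ^ n - 1 ∧
      (∀ M ∈ C, M.rank = n - 1) ∧
      (∀ M₁ ∈ C, ∀ M₂ ∈ C, M₁ ≠ M₂ → (M₁ - M₂).rank = n - 1) := by
  classical
  let e := Fintype.equivFinOfCardEq (card_sigma_fin_eq_choose_two n)
  let f : (Fin n → F) → Matrix (Fin (n.choose 2)) (Fin n) F := fun v =>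
    (wedgeMatrix v).submatrix e.symm (Equiv.refl _)
  have hsub (v w : Fin n → F) : f v - f w = f (v - w) := by
    simp only [f, wedgeMatrix_sub]
    rfl
  have hrank {v : Fin n → F} (hv : v ≠ 0) : (f v).rank = n - 1 := by
    rw [Matrix.rank_submatrix, rank_wedgeMatrix hv]
  have hinj : Function.Injective f := fun v w hvw => by
    by_contra hne
    have h := hrank (sub_ne_zero.mpr hne)
    rw [← hsub, hvw, sub_self, Matrix.rank_zero] at h
    lia
  refine ⟨(Finset.univ.erase 0).image f, ?_, ?_, ?_⟩
  · rw [Finset.card_image_of_injective _ hinj, Finset.card_erase_of_mem (Finset.mem_univ _),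
      Finset.card_univ, Fintype.card_fun, hF, Fintype.card_fin]
  · intro M hM
    obtain ⟨v, hv, rfl⟩ := Finset.mem_image.mp hM
    exact hrank (Finset.ne_of_mem_erase hv)
  · intro M₁ h₁ M₂ h₂ hne
    obtain ⟨v, -, rfl⟩ := Finset.mem_image.mp h₁
    obtain ⟨w, -, rfl⟩ := Finset.mem_image.mp h₂
    rw [hsub]
    exact hrank (sub_ne_zero.mpr fun h => hne (congrArg f h))
end

section
/- For positive integers d ≤ n ≤ N, there exists a d-distance coloring of M_{N×n}(q) with q^{Nd} colors; that is, there is a map Γ from the set of all N×n matrices over F_q to a set of q^{Nd} colors such that Γ(M_1) ≠ Γ(M_2) whenever M_1 ≠ M_2 and the rank of M_1 − M_2 is at most d. -/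
/-- Iterates of the Frobenius map over a finite field `F` commute with `F`-linear combinations. -/
theorem sum_smul_pow_card_pow {F K ι : Type*} [Field F] [Fintype F] [Field K] [Algebra F K]
    [Fintype ι] (c : ι → F) (x : ι → K) (i : ℕ) :
    (∑ k, c k • x k) ^ Fintype.card F ^ i = ∑ k, c k • x k ^ Fintype.card F ^ i := by
  have hσ (y : K) : (FiniteField.frobeniusAlgHom F K ^ i) y = y ^ Fintype.card F ^ i := by
    rw [AlgHom.coe_pow, FiniteField.coe_frobeniusAlgHom, pow_iterate]
  simp_rw [← hσ, map_sum, map_smul]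

open Polynomial in
/-- The Moore matrix of a family in an extension `K` of a finite field `F` is nonsingular
if the family is linearly independent over `F`. -/
theorem det_moore_ne_zero {F K : Type*} [Field F] [Fintype F] [Field K] [Algebra F K] {r : ℕ}
    {g : Fin r → K} (hg : LinearIndependent F g) :
    (Matrix.of fun k i : Fin r => g k ^ Fintype.card F ^ (i : ℕ)).det ≠ 0 := by
  intro hdet
  obtain ⟨a, ha, h⟩ := Matrix.exists_mulVec_eq_zero_iff.mpr hdet
  apply ha
  have hq : 1 < Fintype.card F := Fintype.one_lt_card
  set P : K[X] := ∑ i, C (a i) * X ^ Fintype.card F ^ (i : ℕ) with hP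
  have hP0 : P = 0 := by
    refine eq_zero_of_natDegree_lt_card_of_eval_eq_zero P
      (f := fun c : Fin r → F => ∑ k, c k • g k) ?_ ?_ ?_
    · exact hg.fintypeLinearCombination_injective
    · intro c
      simp only [hP, eval_finsetSum, eval_mul, eval_C, eval_pow, eval_X, sum_smul_pow_card_pow, Finset.mul_sum]
      rw [Finset.sum_comm]
      refine Finset.sum_eq_zero fun k _ => ?_
      have hk := congrFun h k
      simp only [Matrix.mulVec, dotProduct, Matrix.of_apply, Pi.zero_apply] at hk
      simp only [mul_smul_comm, ← Finset.smul_sum]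
      simp_rw [mul_comm (a _), hk, smul_zero]
    · rw [Fintype.card_fun, Fintype.card_fin]
      rcases Nat.eq_zero_or_pos r with rfl | hr
      · simp [hP]
      refine lt_of_le_of_lt (natDegree_sum_le_of_forall_le (n := Fintype.card F ^ (r - 1)) _ _
        fun i _ => (natDegree_C_mul_X_pow_le _ _).trans
          (Nat.pow_le_pow_right (by omega) (by omega)))
        (Nat.pow_lt_pow_right hq (by omega))
  funext i
  have hc := congrArg (coeff · (Fintype.card F ^ (i : ℕ))) hP0
  simpa [hP, finsetSum_coeff, coeff_C_mul, coeff_X_pow, Nat.pow_right_inj hq, Fin.val_inj] using hc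

/-- The `i`-th syndrome of `M`, with respect to a family `e` indexed by the rows and a family `α`
indexed by the columns. -/
def rankSyndrome {F K : Type*} [Field F] [Fintype F] [Field K] [Algebra F K] {N n : ℕ}
    (e : Fin N → K) (α : Fin n → K) (M : Matrix (Fin N) (Fin n) F) (i : ℕ) : K :=
  ∑ j, ∑ s, M s j • (e s * α j ^ Fintype.card F ^ i)

theorem rankSyndrome_sub {F K : Type*} [Field F] [Fintype F] [Field K] [Algebra F K] {N n : ℕ}
    (e : Fin N → K) (α : Fin n → K) (M₁ M₂ : Matrix (Fin N) (Fin n) F) (i : ℕ) :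
    rankSyndrome e α (M₁ - M₂) i = rankSyndrome e α M₁ i - rankSyndrome e α M₂ i := by
  simp [rankSyndrome, sub_smul]

/-- A matrix is zero as soon as its first `M.rank` syndromes vanish. -/
theorem eq_zero_of_rankSyndrome_eq_zero {F K : Type*} [Field F] [Fintype F] [Field K]
    [Algebra F K] {N n : ℕ} {e : Fin N → K} {α : Fin n → K} (he : LinearIndependent F e)
    (hα : LinearIndependent F α) {M : Matrix (Fin N) (Fin n) F}
    (h : ∀ i < M.rank, rankSyndrome e α M i = 0) : M = 0 := by
  let W := Submodule.span F (Set.range M.row)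
  let u : Module.Basis (Fin M.rank) F W :=
    Module.finBasisOfFinrankEq F W M.rank_eq_finrank_span_row.symm
  let B : Fin N → Fin M.rank → F := fun s => u.repr ⟨M s, Submodule.subset_span ⟨s, rfl⟩⟩
  have hB (s : Fin N) (j : Fin n) : M s j = ∑ k, B s k * (u k : Fin n → F) j := by
    have := congrFun (congrArg W.subtype
      (u.sum_repr ⟨M s, Submodule.subset_span ⟨s, rfl⟩⟩)) j
    rw [map_sum, Finset.sum_apply] at this
    exact this.symm
  have hu : LinearIndependent F fun k => (u k : Fin n → F) :=
    u.linearIndependent.map' W.subtype W.ker_subtype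
  let g : Fin M.rank → K := fun k => ∑ j, (u k : Fin n → F) j • α j
  have hg : LinearIndependent F g := by
    have := hu.map' (Fintype.linearCombination F α)
      (LinearMap.ker_eq_bot.mpr hα.fintypeLinearCombination_injective)
    exact this
  have hS (i : ℕ) : rankSyndrome e α M i
      = ∑ k, (∑ s, B s k • e s) * g k ^ Fintype.card F ^ i := by
    simp only [rankSyndrome, hB, g, sum_smul_pow_card_pow, Finset.sum_smul, Finset.sum_mul, Finset.mul_sum,
      smul_mul_smul_comm]
    rw [Finset.sum_comm]
    simp_rw [Finset.sum_comm (γ := Fin n)]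
    rw [Finset.sum_comm]
  have hb : (fun k => ∑ s, B s k • e s) = 0 := by
    refine Matrix.eq_zero_of_vecMul_eq_zero (det_moore_ne_zero hg) (funext fun i => ?_)
    simpa [Matrix.vecMul, dotProduct, ← hS] using h i i.2
  ext s j
  have hB0 (k : Fin M.rank) : B s k = 0 :=
    Fintype.linearIndependent_iff.mp he (fun s => B s k) (congrFun hb k) s
  simp [hB, hB0]

/-- for positive integers d ≤ n ≤ N, there exists a d-distance coloring of
M_{N×n}(q) with q^{Nd} colors. -/
theorem exists_d_distance_coloring (q N n d : ℕ) (F : Type) [Field F] [Fintype F]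
    (hF : Fintype.card F = q) (hd : 0 < d) (hdn : d ≤ n) (hnN : n ≤ N) :
    ∃ Γ : Matrix (Fin N) (Fin n) F → Fin (q ^ (N * d)),
      ∀ M₁ M₂ : Matrix (Fin N) (Fin n) F,
        M₁ ≠ M₂ → (M₁ - M₂).rank ≤ d → Γ M₁ ≠ Γ M₂ := by
  subst hF
  have : NeZero N := ⟨by omega⟩
  obtain ⟨p, hp⟩ := CharP.exists F
  have : Fact p.Prime := ⟨CharP.char_is_prime F p⟩
  let K := FiniteField.Extension F p N
  let e : Module.Basis (Fin N) F K :=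
    Module.finBasisOfFinrankEq F K (FiniteField.finrank_extension F p N)
  have hα : LinearIndependent F (e ∘ Fin.castLE hnN) :=
    e.linearIndependent.comp _ (Fin.castLE_injective hnN)
  have hcard : Nat.card (Fin d → K) = Fintype.card F ^ (N * d) := by
    rw [Nat.card_fun, FiniteField.natCard_extension, Nat.card_fin, Nat.card_eq_fintype_card,
      pow_mul]
  let φ : (Fin d → K) ≃ Fin (Fintype.card F ^ (N * d)) := Finite.equivFinOfCardEq hcard
  refine ⟨fun M => φ fun i => rankSyndrome e (e ∘ Fin.castLE hnN) M i,
    fun M₁ M₂ hne hrank heq => hne (sub_eq_zero.mp ?_)⟩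
  refine eq_zero_of_rankSyndrome_eq_zero e.linearIndependent hα fun i hi => ?_
  rw [rankSyndrome_sub, sub_eq_zero]
  exact congrFun (φ.injective heq) ⟨i, hi.trans_le hrank⟩
end

section
/- For 1 ≤ n ≤ N, χ_1(N×n, q) = q^N: there exists an exactly 1-distance coloring of M_{N×n}(q) with q^N colors, and every exactly 1-distance coloring of M_{N×n}(q) uses at least q^N colors. -/
open Matrix in
/-- A matrix of rank one over a field is the outer product of two nonzero vectors. -/
theorem exists_eq_vecMulVec_of_rank_eq_one {m n F : Type*} [Fintype n] [Finite m] [Field F]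
    {A : Matrix m n F} (hA : A.rank = 1) :
    ∃ u v, u ≠ 0 ∧ v ≠ 0 ∧ A = vecMulVec u v := by
  rw [rank_eq_finrank_span_cols] at hA
  obtain ⟨⟨u, hu⟩, hu0, h⟩ := finrank_eq_one_iff'.1 hA
  have hcol (j : n) : ∃ c : F, c • u = A.col j := by
    obtain ⟨c, hc⟩ := h ⟨A.col j, Submodule.subset_span ⟨j, rfl⟩⟩
    exact ⟨c, congrArg Subtype.val hc⟩
  choose v hv using hcol
  have hAuv : A = vecMulVec u v := by
    ext i j
    simpa [vecMulVec_apply, mul_comm] using (congrFun (hv j) i).symm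
  refine ⟨u, v, fun h0 ↦ hu0 (Subtype.ext h0), ?_, hAuv⟩
  rintro rfl
  have hA0 : A = 0 := by ext i j; simp [hAuv, vecMulVec_apply]
  rw [← rank_eq_finrank_span_cols, hA0, rank_zero] at hA
  exact zero_ne_one hA

open Matrix in
/-- The outer product of two nonzero vectors over a field has rank one. -/
theorem rank_vecMulVec_eq_one {m n F : Type*} [Fintype n] [Fintype m] [Field F]
    {u : m → F} {v : n → F} (hu : u ≠ 0) (hv : v ≠ 0) : (vecMulVec u v).rank = 1 := by
  refine le_antisymm (rank_vecMulVec_le u v) (Nat.one_le_iff_ne_zero.2 fun h ↦ ?_)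
  obtain ⟨i, hi⟩ := Function.ne_iff.1 hu
  obtain ⟨j, hj⟩ := Function.ne_iff.1 hv
  rw [rank_eq_finrank_span_cols, Submodule.finrank_eq_zero, Submodule.span_eq_bot] at h
  exact mul_ne_zero hi hj (congrFun (h _ ⟨j, rfl⟩) i)

/-- A finite field has an extension field of every positive degree. -/
theorem exists_field_extension_finrank_eq (F : Type*) [Field F] [Finite F] {N : ℕ} (hN : N ≠ 0) :
    ∃ (K : Type) (_ : Field K) (_ : Algebra F K),
      Module.Finite F K ∧ Module.finrank F K = N := by
  obtain ⟨p, hp⟩ := CharP.exists F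
  have : Fact p.Prime := ⟨CharP.char_is_prime F p⟩
  have : NeZero N := ⟨hN⟩
  exact ⟨FiniteField.Extension F p N, inferInstance, inferInstance, inferInstance,
    FiniteField.finrank_extension F p N⟩

open Matrix in
/-- If `a` is linearly independent over `F` in an extension field `K`, and `φ` is an injective
linear map into `K`, then the linear map `A ↦ ∑ j, a j * φ (A.col j)` is nonzero on matrices of
rank one. -/
theorem sum_mul_map_col_ne_zero {m n F K : Type*} [Fintype n] [Finite m] [Field F] [Field K]
    [Algebra F K] {a : n → K} (ha : LinearIndependent F a) {φ : (m → F) →ₗ[F] K}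
    (hφ : Function.Injective φ) {A : Matrix m n F} (hA : A.rank = 1) :
    ∑ j, a j * φ (A.col j) ≠ 0 := by
  obtain ⟨u, v, hu, hv, rfl⟩ := exists_eq_vecMulVec_of_rank_eq_one hA
  have hcol (j : n) : (vecMulVec u v).col j = v j • u := by
    ext i
    simp [vecMulVec_apply, mul_comm]
  have hsum : ∑ j, a j * φ ((vecMulVec u v).col j) = (∑ j, v j • a j) * φ u := by
    simp [hcol, Finset.sum_mul]
  rw [hsum]
  refine mul_ne_zero (fun h ↦ hv ?_) ((map_ne_zero_iff φ hφ).2 hu)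
  exact funext (Fintype.linearIndependent_iff.1 ha v h)


/-- for 1 ≤ n ≤ N, χ₁(N×n, q) = q^N: there exists an exactly 1-distance
coloring of M_{N×n}(q) with q^N colors, and every exactly 1-distance coloring of
M_{N×n}(q) uses at least q^N colors. -/
theorem exactly_one_distance_chromatic (q N n : ℕ) (F : Type) [Field F] [Fintype F]
    (hF : Fintype.card F = q) (hn : 0 < n) (hnN : n ≤ N) :
    (∃ Γ : Matrix (Fin N) (Fin n) F → Fin (q ^ N),
      ∀ M₁ M₂ : Matrix (Fin N) (Fin n) F, (M₁ - M₂).rank = 1 → Γ M₁ ≠ Γ M₂) ∧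
    (∀ (L : ℕ) (Γ : Matrix (Fin N) (Fin n) F → Fin L),
      (∀ M₁ M₂ : Matrix (Fin N) (Fin n) F, (M₁ - M₂).rank = 1 → Γ M₁ ≠ Γ M₂) →
      q ^ N ≤ L) := by
  have hcard : Fintype.card (Fin N → F) = q ^ N := by simp [hF]
  constructor
  · obtain ⟨K, _, _, _, hK⟩ := exists_field_extension_finrank_eq F (N := N) (by omega)
    let b : Module.Basis (Fin N) F K := Module.finBasisOfFinrankEq F K hK
    have ha : LinearIndependent F (b ∘ Fin.castLE hnN) :=
      b.linearIndependent.comp _ (Fin.castLE_injective hnN)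
    refine ⟨fun M ↦ Fintype.equivFinOfCardEq hcard
      (b.equivFun (∑ j, (b ∘ Fin.castLE hnN) j * b.equivFun.symm (M.col j))), ?_⟩
    intro M₁ M₂ h heq
    have heq' := b.equivFun.injective ((Fintype.equivFinOfCardEq hcard).injective heq)
    refine sum_mul_map_col_ne_zero ha (φ := b.equivFun.symm.toLinearMap)
      b.equivFun.symm.injective h ?_
    have hcol (j : Fin n) : (M₁ - M₂).col j = M₁.col j - M₂.col j := rfl
    simp only [hcol, map_sub, mul_sub, Finset.sum_sub_distrib]
    exact sub_eq_zero.2 heq'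
  · intro L Γ hΓ
    have hinj : Function.Injective
        fun u : Fin N → F ↦ Γ (Matrix.vecMulVec u (Pi.single ⟨0, hn⟩ 1)) := by
      intro u w huw
      by_contra hne
      refine hΓ _ _ ?_ huw
      rw [← Matrix.sub_vecMulVec]
      exact rank_vecMulVec_eq_one (sub_ne_zero.2 hne) (by simp)
    simpa [hF] using Fintype.card_le_of_injective _ hinj
end

section
/- χ_2(2×2, 2) = 4: there exists a map Γ from the set of all 2×2 matrices over F_2 to a set of 4 colors such that Γ(M_1) ≠ Γ(M_2) whenever the rank of M_1 − M_2 equals 2, and there is no such map into a set of 3 colors. -/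
/-- A matrix with two rows whose first row vanishes does not have rank two. -/
theorem rank_ne_two_of_row_zero_eq_zero {K n : Type*} [Field K] [Fintype n]
    (A : Matrix (Fin 2) n K) (h : A 0 = 0) : A.rank ≠ 2 := by
  have hA : A = Matrix.vecMulVec ![0, 1] (A 1) := by
    ext i j
    fin_cases i
    · simpa [Matrix.vecMulVec_apply] using congrFun h j
    · simp [Matrix.vecMulVec_apply]
  have hle := Matrix.rank_vecMulVec_le ![(0 : K), 1] (A 1)
  rw [← hA] at hle
  omega

/-- The four elements of the copy of the field `F₄` inside the `2 × 2` matrices over `F₂`. -/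
def fieldOfFourMatrix : Fin 4 → Matrix (Fin 2) (Fin 2) (ZMod 2) :=
  ![!![0, 0; 0, 0], !![1, 0; 0, 1], !![0, 1; 1, 1], !![1, 1; 1, 0]]

theorem rank_fieldOfFourMatrix_sub {i j : Fin 4} (hij : i ≠ j) :
    (fieldOfFourMatrix i - fieldOfFourMatrix j).rank = 2 := by
  have hdet : (fieldOfFourMatrix i - fieldOfFourMatrix j).det = 1 := by
    rw [Matrix.det_fin_two]
    revert i j
    decide
  have hunit : IsUnit (fieldOfFourMatrix i - fieldOfFourMatrix j) := by
    rw [Matrix.isUnit_iff_isUnit_det, hdet]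
    exact isUnit_one
  simpa using Matrix.rank_of_isUnit _ hunit


/-- χ₂(2×2, 2) = 4: there exists an exactly 2-distance coloring of the 2×2
matrices over F₂ with 4 colors, and there is no such coloring with 3 colors. -/
theorem exactly_two_distance_chromatic_two_two :
    (∃ Γ : Matrix (Fin 2) (Fin 2) (ZMod 2) → Fin 4,
      ∀ M₁ M₂ : Matrix (Fin 2) (Fin 2) (ZMod 2), (M₁ - M₂).rank = 2 → Γ M₁ ≠ Γ M₂) ∧
    ¬ (∃ Γ : Matrix (Fin 2) (Fin 2) (ZMod 2) → Fin 3,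
      ∀ M₁ M₂ : Matrix (Fin 2) (Fin 2) (ZMod 2), (M₁ - M₂).rank = 2 → Γ M₁ ≠ Γ M₂) := by
  constructor
  · let e : (Fin 2 → ZMod 2) ≃ Fin 4 := Fintype.equivFinOfCardEq (by simp)
    refine ⟨fun M => e (M 0), fun M₁ M₂ hrank hcolor => ?_⟩
    exact rank_ne_two_of_row_zero_eq_zero (M₁ - M₂) (sub_eq_zero.mpr (e.injective hcolor)) hrank
  · rintro ⟨Γ, hΓ⟩
    obtain ⟨i, j, hij, hcolor⟩ :=
      Fintype.exists_ne_map_eq_of_card_lt (fun i => Γ (fieldOfFourMatrix i)) (by simp)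
    exact hΓ _ _ (rank_fieldOfFourMatrix_sub hij) hcolor
end

section
/- χ_3(3×3, 2) = 8: there exists a map Γ from the set of all 3×3 matrices over F_2 to a set of 8 colors such that Γ(M_1) ≠ Γ(M_2) whenever the rank of M_1 − M_2 equals 3, and there is no such map into a set of 7 colors. -/
open Matrix

/-- The embedding of the field with 8 elements, with `F₂`-basis `1, α, α ^ 2` where
`α ^ 3 = α + 1`, into the 3×3 matrices over `F₂`. -/
def fieldMatrix (v : Fin 3 → ZMod 2) : Matrix (Fin 3) (Fin 3) (ZMod 2) :=
  !![v 0, v 2, v 1; v 1, v 0 + v 2, v 1 + v 2; v 2, v 1, v 0 + v 2]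

theorem fieldMatrix_sub (v w : Fin 3 → ZMod 2) :
    fieldMatrix v - fieldMatrix w = fieldMatrix (v - w) := by
  ext i j
  fin_cases i <;> fin_cases j <;> simp [fieldMatrix] <;> ring

theorem det_fieldMatrix_ne_zero {v : Fin 3 → ZMod 2} (hv : v ≠ 0) :
    (fieldMatrix v).det ≠ 0 := by
  have key : ∀ a b c : ZMod 2, a * (a + c) * (a + c) - a * (b + c) * b - c * b * (a + c)
      + c * (b + c) * c + b * b * b - b * (a + c) * c = 0 → a = 0 ∧ b = 0 ∧ c = 0 := by
    decide
  intro h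
  rw [det_fin_three] at h
  obtain ⟨h0, h1, h2⟩ := key (v 0) (v 1) (v 2) (by simpa [fieldMatrix] using h)
  exact hv (by ext i; fin_cases i <;> simp [h0, h1, h2])

theorem rank_fieldMatrix_sub {v w : Fin 3 → ZMod 2} (h : v ≠ w) :
    (fieldMatrix v - fieldMatrix w).rank = 3 := by
  rw [fieldMatrix_sub]
  have hu : IsUnit (fieldMatrix (v - w)) :=
    (isUnit_iff_isUnit_det _).2 (det_fieldMatrix_ne_zero (sub_ne_zero.2 h)).isUnit
  simpa using rank_of_isUnit _ hu

theorem row_ne_of_rank_sub_eq {n : ℕ} {K : Type*} [Field K] {M N : Matrix (Fin n) (Fin n) K}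
    (h : (M - N).rank = n) (i : Fin n) : M i ≠ N i := by
  intro hi
  have hli : LinearIndependent K (M - N).row :=
    linearIndependent_iff_card_eq_finrank_span.2 (by
      rw [Set.finrank, ← rank_eq_finrank_span_row, h, Fintype.card_fin])
  exact hli.ne_zero i (by ext j; simp [hi])

/-- χ₃(3×3, 2) = 8: there exists an exactly 3-distance coloring of the 3×3
matrices over F₂ with 8 colors, and there is no such coloring with 7 colors. -/
theorem exactly_three_distance_chromatic_three_three :
    (∃ Γ : Matrix (Fin 3) (Fin 3) (ZMod 2) → Fin 8,
      ∀ M₁ M₂ : Matrix (Fin 3) (Fin 3) (ZMod 2), (M₁ - M₂).rank = 3 → Γ M₁ ≠ Γ M₂) ∧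
    ¬ (∃ Γ : Matrix (Fin 3) (Fin 3) (ZMod 2) → Fin 7,
      ∀ M₁ M₂ : Matrix (Fin 3) (Fin 3) (ZMod 2), (M₁ - M₂).rank = 3 → Γ M₁ ≠ Γ M₂) := by
  have hcard : Fintype.card (Fin 3 → ZMod 2) = 8 := by simp [ZMod.card]
  constructor
  · let e := Fintype.equivFinOfCardEq hcard
    exact ⟨fun M => e (M 0), fun M N h heq => row_ne_of_rank_sub_eq h 0 (e.injective heq)⟩
  · rintro ⟨Γ, hΓ⟩
    obtain ⟨v, w, hvw, heq⟩ := Fintype.exists_ne_map_eq_of_card_lt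
      (fun v : Fin 3 → ZMod 2 => Γ (fieldMatrix v)) (by simp [hcard])
    exact hΓ _ _ (rank_fieldMatrix_sub hvw) heq
end
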